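/- Let Ω ⊂ ℝⁿ be a bounded open set, let f : Ω × ℝ × ℝⁿ → ℝ be measurable, and let g be a bounded Lipschitz function on Ω. If u₁, u₂ ∈ A_sup(g,Ω), i.e. each is a minimizer of F(·,Ω) over W_g^{1,∞}(Ω) and an absolute superminimizer of F on Ω, then u = min(u₁, u₂) belongs to A_sup(g,Ω). (Lemma 3.1(ii).) -/

import Mathlib

open MeasureTheory Filter Set

/-- The supremal functional `F(u,V) = ess sup_{x ∈ V} f(x, u(x), Du(x))`, valued in `EReal`. -/
noncomputable def suprF {n : ℕ} (f : EuclideanSpace ℝ (Fin n) → ℝ → EuclideanSpace ℝ (Fin n) → ℝ)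
    (u : EuclideanSpace ℝ (Fin n) → ℝ) (V : Set (EuclideanSpace ℝ (Fin n))) : EReal :=
  essSup (fun x => ((f x (u x) (gradient u x) : ℝ) : EReal)) (volume.restrict V)

/-- Hypothesis (H1): lower semicontinuity in `(s,p)` for a.e. `x ∈ Ω`, and
quasiconvexity (level-convexity) of `p ↦ f x s p` for all `(x,s)`. -/
def H1 {n : ℕ} (Ω : Set (EuclideanSpace ℝ (Fin n)))
    (f : EuclideanSpace ℝ (Fin n) → ℝ → EuclideanSpace ℝ (Fin n) → ℝ) : Prop :=
  (∀ᵐ x ∂(volume.restrict Ω),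
      LowerSemicontinuous (fun sp : ℝ × EuclideanSpace ℝ (Fin n) => f x sp.1 sp.2)) ∧
  (∀ x ∈ Ω, ∀ s : ℝ, ∀ p q : EuclideanSpace ℝ (Fin n), ∀ t : ℝ, 0 ≤ t → t ≤ 1 →
      f x s (t • p + (1 - t) • q) ≤ max (f x s p) (f x s q))

/-- Hypothesis (H2): uniform coercivity. -/
def H2 {n : ℕ} (Ω : Set (EuclideanSpace ℝ (Fin n)))
    (f : EuclideanSpace ℝ (Fin n) → ℝ → EuclideanSpace ℝ (Fin n) → ℝ) : Prop :=
  ∀ c : ℝ, ∃ R : ℝ, 0 ≤ R ∧ ∀ x ∈ Ω, ∀ s : ℝ, ∀ p : EuclideanSpace ℝ (Fin n),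
    f x s p ≤ c → ‖p‖ ≤ R

/-- `u` is a bounded Lipschitz function on `V` (i.e. `u ∈ W^{1,∞}(V)`). -/
def BddLipschitzOn {n : ℕ} (u : EuclideanSpace ℝ (Fin n) → ℝ)
    (V : Set (EuclideanSpace ℝ (Fin n))) : Prop :=
  (∃ K : NNReal, LipschitzOnWith K u V) ∧ ∃ M : ℝ, ∀ x ∈ V, |u x| ≤ M

/-- `u` is locally Lipschitz on `Ω`. -/
def LocLipschitzOn {n : ℕ} (u : EuclideanSpace ℝ (Fin n) → ℝ)
    (Ω : Set (EuclideanSpace ℝ (Fin n))) : Prop :=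
  ∀ x ∈ Ω, ∃ s ∈ nhds x, ∃ K : NNReal, LipschitzOnWith K u s

/-- The Dirichlet class `W_g^{1,∞}(Ω)`: bounded Lipschitz functions `u` on `Ω` such that
`u - g` extends continuously by zero to the boundary `∂Ω`. -/
def DirichletClass {n : ℕ} (Ω : Set (EuclideanSpace ℝ (Fin n)))
    (g u : EuclideanSpace ℝ (Fin n) → ℝ) : Prop :=
  BddLipschitzOn u Ω ∧
  ∀ x ∈ frontier Ω, Tendsto (fun y => u y - g y) (nhdsWithin x Ω) (nhds 0)

/-- `u ∈ A(g,Ω)`: `u` minimizes `F(·,Ω)` over `W_g^{1,∞}(Ω)`. -/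
def Minimizes {n : ℕ} (f : EuclideanSpace ℝ (Fin n) → ℝ → EuclideanSpace ℝ (Fin n) → ℝ)
    (Ω : Set (EuclideanSpace ℝ (Fin n))) (g u : EuclideanSpace ℝ (Fin n) → ℝ) : Prop :=
  DirichletClass Ω g u ∧ ∀ v, DirichletClass Ω g v → suprF f u Ω ≤ suprF f v Ω

/-- `u` is an absolute superminimizer of `F` on `Ω`. -/
def AbsSuper {n : ℕ} (f : EuclideanSpace ℝ (Fin n) → ℝ → EuclideanSpace ℝ (Fin n) → ℝ)
    (Ω : Set (EuclideanSpace ℝ (Fin n))) (u : EuclideanSpace ℝ (Fin n) → ℝ) : Prop :=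
  ∀ V : Set (EuclideanSpace ℝ (Fin n)), IsOpen V → IsCompact (closure V) → closure V ⊆ Ω →
    ∀ v : EuclideanSpace ℝ (Fin n) → ℝ,
      (∃ K : NNReal, LipschitzOnWith K v V) → ContinuousOn v (closure V) →
      (∀ x ∈ V, u x < v x) → (∀ x ∈ frontier V, v x = u x) →
      suprF f u V ≤ suprF f v V

/-- `u` is an absolute subminimizer of `F` on `Ω`. -/
def AbsSub {n : ℕ} (f : EuclideanSpace ℝ (Fin n) → ℝ → EuclideanSpace ℝ (Fin n) → ℝ)
    (Ω : Set (EuclideanSpace ℝ (Fin n))) (u : EuclideanSpace ℝ (Fin n) → ℝ) : Prop :=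
  ∀ V : Set (EuclideanSpace ℝ (Fin n)), IsOpen V → IsCompact (closure V) → closure V ⊆ Ω →
    ∀ v : EuclideanSpace ℝ (Fin n) → ℝ,
      (∃ K : NNReal, LipschitzOnWith K v V) → ContinuousOn v (closure V) →
      (∀ x ∈ V, v x < u x) → (∀ x ∈ frontier V, v x = u x) →
      suprF f u V ≤ suprF f v V

/-- `u` is an absolute minimizer of `F` on `Ω`: `F(v,V) ≥ F(u,V)` for every `V ⊂⊂ Ω` and every
`v ∈ W^{1,∞}(V) ∩ C(V̄)` with `v = u` on `∂V`. -/
def AbsMin {n : ℕ} (f : EuclideanSpace ℝ (Fin n) → ℝ → EuclideanSpace ℝ (Fin n) → ℝ)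
    (Ω : Set (EuclideanSpace ℝ (Fin n))) (u : EuclideanSpace ℝ (Fin n) → ℝ) : Prop :=
  ∀ V : Set (EuclideanSpace ℝ (Fin n)), IsOpen V → IsCompact (closure V) → closure V ⊆ Ω →
    ∀ v : EuclideanSpace ℝ (Fin n) → ℝ,
      (∃ K : NNReal, LipschitzOnWith K v V) → ContinuousOn v (closure V) →
      (∀ x ∈ frontier V, v x = u x) →
      suprF f u V ≤ suprF f v V

/-- Two functions differentiable at a point where one touches the other from below have the same
gradient there. -/
theorem gradient_eq_of_le_of_eq {E : Type*} [NormedAddCommGroup E] [InnerProductSpace ℝ E]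
    [CompleteSpace E] {u w : E → ℝ} {x : E} (hu : DifferentiableAt ℝ u x)
    (hw : DifferentiableAt ℝ w x) (hle : ∀ y, u y ≤ w y) (hx : u x = w x) :
    gradient u x = gradient w x := by
  have hmin : IsLocalMin (fun y => w y - u y) x :=
    Eventually.of_forall fun y => by simp only [hx, sub_self, sub_nonneg, hle y]
  have h := hmin.fderiv_eq_zero
  rw [fderiv_fun_sub hw hu, sub_eq_zero] at h
  simp only [gradient, h]

/-- Rademacher's theorem on an open set, with the full derivative. -/
theorem LipschitzOnWith.ae_restrict_differentiableAt {n : ℕ}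
    {Ω : Set (EuclideanSpace ℝ (Fin n))} (hΩ : IsOpen Ω) {K : NNReal}
    {u : EuclideanSpace ℝ (Fin n) → ℝ} (hu : LipschitzOnWith K u Ω) :
    ∀ᵐ x ∂(volume.restrict Ω), DifferentiableAt ℝ u x := by
  rw [ae_restrict_iff' hΩ.measurableSet]
  filter_upwards [hu.ae_differentiableWithinAt_of_mem (μ := volume)] with x hx hxΩ
  exact (hx hxΩ).differentiableAt (hΩ.mem_nhds hxΩ)

theorem LipschitzOnWith.min_fun {α : Type*} [PseudoEMetricSpace α] {s : Set α} {K₁ K₂ : NNReal}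
    {u₁ u₂ : α → ℝ} (h₁ : LipschitzOnWith K₁ u₁ s) (h₂ : LipschitzOnWith K₂ u₂ s) :
    LipschitzOnWith (max K₁ K₂) (fun x => min (u₁ x) (u₂ x)) s := by
  rw [lipschitzOnWith_iff_restrict] at *
  exact h₁.min h₂

theorem suprF_mono {n : ℕ}
    (f : EuclideanSpace ℝ (Fin n) → ℝ → EuclideanSpace ℝ (Fin n) → ℝ)
    (u : EuclideanSpace ℝ (Fin n) → ℝ) {V W : Set (EuclideanSpace ℝ (Fin n))} (h : V ⊆ W) :
    suprF f u V ≤ suprF f u W :=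
  essSup_mono_measure (Measure.absolutelyContinuous_of_le (Measure.restrict_mono h le_rfl))

theorem ae_le_suprF {n : ℕ}
    (f : EuclideanSpace ℝ (Fin n) → ℝ → EuclideanSpace ℝ (Fin n) → ℝ)
    (u : EuclideanSpace ℝ (Fin n) → ℝ) {V : Set (EuclideanSpace ℝ (Fin n))} (hV : IsOpen V) :
    ∀ᵐ x, x ∈ V → ((f x (u x) (gradient u x) : ℝ) : EReal) ≤ suprF f u V :=
  (ae_restrict_iff' hV.measurableSet).1 (ae_le_essSup (by isBoundedDefault))

/-- A bound for the supremal functional of a minimum over `V`, from bounds on each function over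
an open set containing the points of `V` at which it realizes the minimum. -/
theorem suprF_min_le {n : ℕ}
    (f : EuclideanSpace ℝ (Fin n) → ℝ → EuclideanSpace ℝ (Fin n) → ℝ)
    {u₁ u₂ : EuclideanSpace ℝ (Fin n) → ℝ} {V V₁ V₂ : Set (EuclideanSpace ℝ (Fin n))}
    (hV : IsOpen V) (hV₁ : IsOpen V₁) (hV₂ : IsOpen V₂) {K₁ K₂ : NNReal}
    (h₁ : LipschitzOnWith K₁ u₁ V) (h₂ : LipschitzOnWith K₂ u₂ V)
    (hsub₁ : ∀ x ∈ V, u₁ x ≤ u₂ x → x ∈ V₁) (hsub₂ : ∀ x ∈ V, u₂ x ≤ u₁ x → x ∈ V₂)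
    {c : EReal} (hc₁ : suprF f u₁ V₁ ≤ c) (hc₂ : suprF f u₂ V₂ ≤ c) :
    suprF f (fun x => min (u₁ x) (u₂ x)) V ≤ c := by
  refine essSup_le_of_ae_le c ?_
  filter_upwards [h₁.ae_restrict_differentiableAt hV, h₂.ae_restrict_differentiableAt hV,
    (h₁.min_fun h₂).ae_restrict_differentiableAt hV, ae_restrict_mem hV.measurableSet,
    ae_restrict_of_ae (ae_le_suprF f u₁ hV₁), ae_restrict_of_ae (ae_le_suprF f u₂ hV₂)]
    with x d₁ d₂ d hx b₁ b₂
  rcases le_total (u₁ x) (u₂ x) with h | h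
  · have hm : min (u₁ x) (u₂ x) = u₁ x := min_eq_left h
    rw [gradient_eq_of_le_of_eq d d₁ (fun _ => min_le_left _ _) hm, hm]
    exact (b₁ (hsub₁ x hx h)).trans hc₁
  · have hm : min (u₁ x) (u₂ x) = u₂ x := min_eq_right h
    rw [gradient_eq_of_le_of_eq d d₂ (fun _ => min_le_right _ _) hm, hm]
    exact (b₂ (hsub₂ x hx h)).trans hc₂

theorem DirichletClass.min {n : ℕ} {Ω : Set (EuclideanSpace ℝ (Fin n))}
    {g u₁ u₂ : EuclideanSpace ℝ (Fin n) → ℝ}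
    (h₁ : DirichletClass Ω g u₁) (h₂ : DirichletClass Ω g u₂) :
    DirichletClass Ω g (fun x => min (u₁ x) (u₂ x)) := by
  obtain ⟨⟨⟨K₁, hK₁⟩, M₁, hM₁⟩, ht₁⟩ := h₁
  obtain ⟨⟨⟨K₂, hK₂⟩, M₂, hM₂⟩, ht₂⟩ := h₂
  refine ⟨⟨⟨_, hK₁.min_fun hK₂⟩, max M₁ M₂, fun x hx => ?_⟩, fun x hx => ?_⟩
  · exact abs_min_le_max_abs_abs.trans (max_le_max (hM₁ x hx) (hM₂ x hx))
  · simpa only [min_sub_sub_right, min_self] using (ht₁ x hx).min (ht₂ x hx)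

/-- The part of `V` on which a competitor `v` lies above a superminimizer `w` is admissible, as soon
as `v ≤ w` on the boundary of `V`. -/
theorem AbsSuper.suprF_le_of_le_frontier {n : ℕ}
    {f : EuclideanSpace ℝ (Fin n) → ℝ → EuclideanSpace ℝ (Fin n) → ℝ}
    {Ω V : Set (EuclideanSpace ℝ (Fin n))} {w v : EuclideanSpace ℝ (Fin n) → ℝ}
    (hw : AbsSuper f Ω w) (hwc : ContinuousOn w Ω) (hV : IsOpen V)
    (hVc : IsCompact (closure V)) (hVΩ : closure V ⊆ Ω) {K : NNReal}
    (hvl : LipschitzOnWith K v V) (hvc : ContinuousOn v (closure V))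
    (hfr : ∀ x ∈ frontier V, v x ≤ w x) :
    IsOpen {x ∈ V | w x < v x} ∧ suprF f w {x ∈ V | w x < v x} ≤ suprF f v V := by
  have hsub : {x ∈ V | w x < v x} ⊆ V := fun x hx => hx.1
  have hcl := closure_mono hsub
  have hopen : IsOpen {x ∈ V | w x < v x} := by
    have hc : ContinuousOn (fun x => v x - w x) V :=
      (hvc.mono subset_closure).sub (hwc.mono (subset_closure.trans hVΩ))
    convert hc.isOpen_inter_preimage hV (isOpen_Ioi (a := (0 : ℝ))) using 1
    ext x
    simp
  refine ⟨hopen, (hw _ hopen (hVc.of_isClosed_subset isClosed_closure hcl) (hcl.trans hVΩ) v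
    ⟨K, hvl.mono hsub⟩ (hvc.mono hcl) (fun x hx => hx.2) fun x hx => ?_).trans
    (suprF_mono f v hsub)⟩
  rw [hopen.frontier_eq] at hx
  have hxV : x ∈ closure V := hcl hx.1
  refine le_antisymm ?_ ?_
  · by_cases hxm : x ∈ V
    · exact not_lt.1 fun hlt => hx.2 ⟨hxm, hlt⟩
    · exact hfr x (by rw [hV.frontier_eq]; exact ⟨hxV, hxm⟩)
  · exact ContinuousWithinAt.closure_le hx.1 ((hwc x (hVΩ hxV)).mono (hsub.trans
      (subset_closure.trans hVΩ))) ((hvc x hxV).mono (hsub.trans subset_closure))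
      fun y hy => hy.2.le

/-- Lemma 3.1(ii): if `u₁, u₂ ∈ A_sup(g,Ω)` then `min(u₁,u₂) ∈ A_sup(g,Ω)`. -/
theorem stmt6 {n : ℕ} (Ω : Set (EuclideanSpace ℝ (Fin n)))
    (hΩo : IsOpen Ω) (hΩb : Bornology.IsBounded Ω)
    (f : EuclideanSpace ℝ (Fin n) → ℝ → EuclideanSpace ℝ (Fin n) → ℝ)
    (hfm : Measurable (fun q : EuclideanSpace ℝ (Fin n) × ℝ × EuclideanSpace ℝ (Fin n) =>
      f q.1 q.2.1 q.2.2))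
    (g : EuclideanSpace ℝ (Fin n) → ℝ) (hg : BddLipschitzOn g Ω)
    (u₁ u₂ : EuclideanSpace ℝ (Fin n) → ℝ)
    (h₁ : Minimizes f Ω g u₁ ∧ AbsSuper f Ω u₁)
    (h₂ : Minimizes f Ω g u₂ ∧ AbsSuper f Ω u₂) :
    Minimizes f Ω g (fun x => min (u₁ x) (u₂ x)) ∧
      AbsSuper f Ω (fun x => min (u₁ x) (u₂ x)) := by
  obtain ⟨⟨hD₁, hm₁⟩, hs₁⟩ := h₁
  obtain ⟨⟨hD₂, hm₂⟩, hs₂⟩ := h₂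
  obtain ⟨K₁, hK₁⟩ := hD₁.1.1
  obtain ⟨K₂, hK₂⟩ := hD₂.1.1
  refine ⟨⟨hD₁.min hD₂, fun v hv => ?_⟩, fun V hV hVc hVΩ v ⟨K, hvl⟩ hvc hlt hfr => ?_⟩
  · exact suprF_min_le f hΩo hΩo hΩo hK₁ hK₂ (fun _ hx _ => hx) (fun _ hx _ => hx)
      (hm₁ v hv) (hm₂ v hv)
  · have hVs : V ⊆ Ω := subset_closure.trans hVΩ
    obtain ⟨ho₁, hle₁⟩ := hs₁.suprF_le_of_le_frontier hK₁.continuousOn hV hVc hVΩ hvl hvc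
      fun x hx => (hfr x hx).trans_le (min_le_left _ _)
    obtain ⟨ho₂, hle₂⟩ := hs₂.suprF_le_of_le_frontier hK₂.continuousOn hV hVc hVΩ hvl hvc
      fun x hx => (hfr x hx).trans_le (min_le_right _ _)
    exact suprF_min_le f hV ho₁ ho₂ (hK₁.mono hVs) (hK₂.mono hVs)
      (fun x hx h => ⟨hx, (min_eq_left h).symm.trans_lt (hlt x hx)⟩)
      (fun x hx h => ⟨hx, (min_eq_right h).symm.trans_lt (hlt x hx)⟩) hle₁ hle₂
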